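/- Let Q_1, Q_2 ∈ S be quasi-homogeneous with respect to u ∈ ℤ_{>0}^n, with u + v = k·(1,...,1), such that the reductions Q_1^{red} and Q_2^{red} have no common factor. Then χ(D^{(u,v)}(Q_1) + D^{(u,v)}(Q_2)) = v_1 + ... + v_n. -/

import Mathlib

open MvPolynomial

/-- A derivation `δ = Σ aᵢ ∂ᵢ` is represented by its coefficient vector `a`;
`derMap g a = δ(g)`. -/
noncomputable def derMap {K : Type} [Field K] {n : ℕ} (g : MvPolynomial (Fin n) K) :
    (Fin n → MvPolynomial (Fin n) K) →ₗ[MvPolynomial (Fin n) K] MvPolynomial (Fin n) K where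
  toFun a := ∑ i, a i * MvPolynomial.pderiv i g
  map_add' a b := by simp [add_mul, Finset.sum_add_distrib]
  map_smul' c a := by simp [Finset.mul_sum, mul_assoc]

/-- `D(g; k) = {δ : g^k ∣ δ(g)}`. -/
noncomputable def Dgk {K : Type} [Field K] {n : ℕ} (g : MvPolynomial (Fin n) K) (k : ℕ) :
    Submodule (MvPolynomial (Fin n) K) (Fin n → MvPolynomial (Fin n) K) :=
  Submodule.comap (derMap g) (Ideal.span {g ^ k})

/-- `D(f) = ⋂ D(fᵢ; eᵢ)` for the irreducible factorization `f = ∏ fᵢ^{eᵢ}`. -/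
noncomputable def DQ {K : Type} [Field K] {n r : ℕ} (f : Fin r → MvPolynomial (Fin n) K)
    (e : Fin r → ℕ) : Submodule (MvPolynomial (Fin n) K) (Fin n → MvPolynomial (Fin n) K) :=
  ⨅ i, Dgk (f i) (e i)

/-- The degree-`m` graded piece (a `K`-vector space) of a submodule `M` of
`Der_K(S) = ⊕ᵢ S^u(-vᵢ)` for the `(u,v)`-grading. -/
noncomputable def gPiece {K : Type} [Field K] {n : ℕ} (u v : Fin n → ℤ)
    (M : Submodule (MvPolynomial (Fin n) K) (Fin n → MvPolynomial (Fin n) K)) (m : ℤ) :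
    Submodule K (Fin n → MvPolynomial (Fin n) K) :=
  Submodule.restrictScalars K M ⊓
    Submodule.pi Set.univ (fun i => weightedHomogeneousSubmodule K u (m - v i))

/-- The Hilbert function `m ↦ dim_K Mₘ` of a `(u,v)`-graded submodule of `Der_K(S)`. -/
noncomputable def hpDer {K : Type} [Field K] {n : ℕ} (u v : Fin n → ℤ)
    (M : Submodule (MvPolynomial (Fin n) K) (Fin n → MvPolynomial (Fin n) K)) (m : ℤ) : ℤ :=
  (Module.finrank K ↥(gPiece u v M m) : ℤ)

/-- `χ` of a Laurent polynomial `Σ aₘ tᵐ` given by its (finitely supported)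
coefficient function: the derivative at `t = 1`, namely `Σ m·aₘ`. -/
noncomputable def chi (c : ℤ →₀ ℤ) : ℤ := c.sum fun m a => m * a

/-- `c` is the coefficient function of `∏ᵢ(1-t^{uᵢ})·F(t)` where `F(t) = Σ F(m) tᵐ`. -/
def numRel {n : ℕ} (u : Fin n → ℤ) (c : ℤ →₀ ℤ) (F : ℤ → ℤ) : Prop :=
  ∀ m : ℤ, c m = ∑ A : Finset (Fin n), (-1 : ℤ) ^ A.card * F (m - ∑ i ∈ A, u i)

section HilbertSeries

variable {K : Type} [Field K] {n : ℕ}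

/-- The dimension of the degree-`m` piece of `K[x₁, …, xₙ]` graded by the weights `u`. -/
noncomputable def polyHilbert (K : Type) [Field K] {n : ℕ} (u : Fin n → ℤ) (m : ℤ) : ℕ :=
  Module.finrank K (weightedHomogeneousSubmodule K u m)

theorem finite_setOf_weight_eq {u : Fin n → ℤ} (hu : ∀ i, 0 < u i) (m : ℤ) :
    {d : Fin n →₀ ℕ | Finsupp.weight u d = m}.Finite := by
  refine (Set.finite_Iic (Finsupp.equivFunOnFinite.symm fun _ => m.toNat)).subset fun d hd i => ?_
  have hd : ∑ j, (d j : ℤ) * u j = m := by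
    simpa [Finsupp.weight_apply, Finsupp.sum_fintype] using hd
  have hle : (d i : ℤ) * u i ≤ ∑ j, (d j : ℤ) * u j :=
    Finset.single_le_sum (f := fun j => (d j : ℤ) * u j)
      (fun j _ => mul_nonneg (by positivity) (hu j).le) (Finset.mem_univ i)
  have hdi : (d i : ℤ) ≤ m := by nlinarith [hu i]
  simpa using (by omega : d i ≤ m.toNat)

theorem finiteDimensional_weightedHomogeneousSubmodule {u : Fin n → ℤ} (hu : ∀ i, 0 < u i)
    (m : ℤ) : FiniteDimensional K (weightedHomogeneousSubmodule K u m) := by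
  rw [weightedHomogeneousSubmodule_eq_finsupp_supported]
  have := (finite_setOf_weight_eq hu m).to_subtype
  exact Module.Finite.of_basis (basisRestrictSupport K {d | Finsupp.weight u d = m})

theorem polyHilbert_eq_card (u : Fin n → ℤ) (m : ℤ) :
    polyHilbert K u m = Nat.card {d : Fin n →₀ ℕ | Finsupp.weight u d = m} := by
  rw [polyHilbert, weightedHomogeneousSubmodule_eq_finsupp_supported]
  exact Module.finrank_eq_nat_card_basis
    (basisRestrictSupport K {d | Finsupp.weight u d = m})

theorem zpow_sum_eq_prod {ι : Type*} {t : ℝ} (ht : t ≠ 0) (A : Finset ι) (a : ι → ℤ) :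
    t ^ (∑ i ∈ A, a i) = ∏ i ∈ A, t ^ a i := by
  classical
  induction A using Finset.induction_on with
  | empty => simp
  | insert i A hi ih => rw [Finset.sum_insert hi, Finset.prod_insert hi, zpow_add₀ ht, ih]

theorem hasSum_prod_pi_of_nonneg {n : ℕ} {f : Fin n → ℕ → ℝ} {s : Fin n → ℝ}
    (h0 : ∀ i a, 0 ≤ f i a) (hs : ∀ i, HasSum (f i) (s i)) :
    HasSum (fun a : Fin n → ℕ => ∏ i, f i (a i)) (∏ i, s i) := by
  induction n with
  | zero => simp
  | succ n ih =>
    have ih' := ih (fun i => h0 i.succ) fun i => hs i.succ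
    have hnonneg : 0 ≤ fun a : Fin n → ℕ => ∏ i, f i.succ (a i) :=
      fun a => Finset.prod_nonneg fun i _ => h0 _ _
    have hsum := (hs 0).summable.mul_of_nonneg ih'.summable (h0 0) hnonneg
    have hmul := (hs 0).mul ih' hsum
    rw [Fin.prod_univ_succ, ← (Fin.consEquiv fun _ => ℕ).hasSum_iff]
    simpa [Function.comp_def, Fin.prod_univ_succ] using hmul

theorem hasSum_polyHilbert {u : Fin n → ℤ} (hu : ∀ i, 0 < u i) {t : ℝ} (ht0 : 0 < t)
    (ht1 : t < 1) :
    HasSum (fun m : ℤ => (polyHilbert K u m : ℝ) * t ^ m) (∏ i, (1 - t ^ u i)⁻¹) := by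
  have hprod : HasSum (fun a : Fin n → ℕ => ∏ i, (t ^ u i) ^ a i) (∏ i, (1 - t ^ u i)⁻¹) :=
    hasSum_prod_pi_of_nonneg (fun i a => by positivity) fun i =>
      hasSum_geometric_of_lt_one (by positivity)
        (by simpa using zpow_lt_zpow_right_of_lt_one₀ ht0 ht1 (hu i))
  rw [← (Finsupp.equivFunOnFinite (α := Fin n) (M := ℕ)).hasSum_iff] at hprod
  refine (congrArg (HasSum · _) (funext fun m => ?_)).mpr
    (hprod.tsum_fiberwise fun d : Fin n →₀ ℕ => Finsupp.weight u d)
  have hconst (d : (fun d : Fin n →₀ ℕ => Finsupp.weight u d) ⁻¹' {m}) :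
      ((fun a : Fin n → ℕ => ∏ i, (t ^ u i) ^ a i) ∘ Finsupp.equivFunOnFinite) d = t ^ m := by
    have hd : ∑ j, (d.1 j : ℤ) * u j = m := by
      simpa [Finsupp.weight_apply, Finsupp.sum_fintype] using d.2
    refine Eq.trans ?_ (congrArg (t ^ ·) hd)
    simp [zpow_sum_eq_prod ht0.ne', mul_comm, zpow_mul]
  simp_rw [hconst, tsum_const, polyHilbert_eq_card, nsmul_eq_mul]
  rfl

theorem hasSum_comp_sub_mul_zpow {F : ℤ → ℝ} {t s : ℝ} (ht : t ≠ 0)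
    (h : HasSum (fun m => F m * t ^ m) s) (a : ℤ) :
    HasSum (fun m => F (m - a) * t ^ m) (t ^ a * s) := by
  rw [← (Equiv.addRight a).hasSum_iff]
  refine (congrArg (HasSum · _) (funext fun m => ?_)).mpr (h.mul_left (t ^ a))
  simp [zpow_add₀ ht]
  ring

theorem numRel.sum_mul_zpow {u : Fin n → ℤ} {c : ℤ →₀ ℤ} {F : ℤ → ℤ} (hc : numRel u c F)
    {t s : ℝ} (ht : t ≠ 0) (h : HasSum (fun m => (F m : ℝ) * t ^ m) s) :
    (c.sum fun m a => (a : ℝ) * t ^ m) = (∏ i, (1 - t ^ u i)) * s := by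
  have hfin : HasSum (fun m => (c m : ℝ) * t ^ m) (c.sum fun m a => (a : ℝ) * t ^ m) :=
    hasSum_sum_of_ne_finset_zero fun m hm => by simp [Finsupp.notMem_support_iff.mp hm]
  have hsum : HasSum (fun m => ∑ A : Finset (Fin n),
      (-1 : ℝ) ^ A.card * ((F (m - ∑ i ∈ A, u i) : ℝ) * t ^ m))
      (∑ A : Finset (Fin n), (-1 : ℝ) ^ A.card * (t ^ (∑ i ∈ A, u i) * s)) :=
    hasSum_sum fun A _ => (hasSum_comp_sub_mul_zpow (F := fun m => (F m : ℝ)) ht h _).mul_left _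
  have hprod : ∏ i, (1 - t ^ u i) =
      ∑ A : Finset (Fin n), (-1 : ℝ) ^ A.card * t ^ (∑ i ∈ A, u i) := by
    simp_rw [sub_eq_add_neg, Finset.prod_one_add, Finset.powerset_univ, Finset.prod_neg,
      zpow_sum_eq_prod ht]
  rw [hprod, Finset.sum_mul]
  simp only [mul_assoc]
  refine hfin.unique ?_
  convert hsum using 1
  funext m
  rw [hc m]
  push_cast
  simp [Finset.sum_mul, mul_assoc]

end HilbertSeries

section Dimension

variable {K : Type} [Field K] {n : ℕ}

theorem MvPolynomial.IsWeightedHomogeneous.of_mul_left {u : Fin n → ℤ}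
    {Q b : MvPolynomial (Fin n) K} {d m : ℤ} (hQ0 : Q ≠ 0)
    (hQ : Q.IsWeightedHomogeneous u d) (hb : (Q * b).IsWeightedHomogeneous u m) :
    b.IsWeightedHomogeneous u (m - d) := by
  classical
  let := weightedGradedAlgebra K u
  have hmul := DirectSum.coe_decompose_mul_add_of_left_mem (weightedHomogeneousSubmodule K u)
    (a := Q) (b := b) (i := d) (j := m - d) hQ
  rw [add_sub_cancel, DirectSum.decompose_of_mem_same _ hb] at hmul
  rw [mul_left_cancel₀ hQ0 hmul]
  exact (DirectSum.decompose (weightedHomogeneousSubmodule K u) b (m - d)).2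

theorem finrank_map_mulLeft {Q : MvPolynomial (Fin n) K} (hQ : Q ≠ 0)
    (V : Submodule K (MvPolynomial (Fin n) K)) :
    Module.finrank K (V.map (LinearMap.mulLeft K Q)) = Module.finrank K V :=
  (Submodule.equivMapOfInjective _ (mul_right_injective₀ hQ) V).finrank_eq.symm

/-- The part of `(Q₁, Q₂)` of degree `m`, where `Qᵢ` has degree `dᵢ`. -/
noncomputable def idealPiece (u : Fin n → ℤ) (Q₁ Q₂ : MvPolynomial (Fin n) K) (d₁ d₂ m : ℤ) :
    Submodule K (MvPolynomial (Fin n) K) :=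
  (weightedHomogeneousSubmodule K u (m - d₁)).map (LinearMap.mulLeft K Q₁) ⊔
    (weightedHomogeneousSubmodule K u (m - d₂)).map (LinearMap.mulLeft K Q₂)

theorem idealPiece_le {u : Fin n → ℤ} {Q₁ Q₂ : MvPolynomial (Fin n) K} {d₁ d₂ : ℤ}
    (hQ₁ : Q₁.IsWeightedHomogeneous u d₁) (hQ₂ : Q₂.IsWeightedHomogeneous u d₂) (m : ℤ) :
    idealPiece u Q₁ Q₂ d₁ d₂ m ≤ weightedHomogeneousSubmodule K u m := by
  refine sup_le ?_ ?_ <;> rintro _ ⟨b, hb, rfl⟩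
  · simpa using hQ₁.mul hb
  · simpa using hQ₂.mul hb

theorem le_finrank_idealPiece {u : Fin n → ℤ} (hu : ∀ i, 0 < u i)
    {Q₁ Q₂ : MvPolynomial (Fin n) K} {d₁ d₂ : ℤ} (h₁ : Q₁ ≠ 0) (h₂ : Q₂ ≠ 0)
    (hQ₁ : Q₁.IsWeightedHomogeneous u d₁) (hrel : IsRelPrime Q₁ Q₂) (m : ℤ) :
    polyHilbert K u (m - d₁) + polyHilbert K u (m - d₂) ≤
      Module.finrank K (idealPiece u Q₁ Q₂ d₁ d₂ m) + polyHilbert K u (m - (d₁ + d₂)) := by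
  have hfin := finiteDimensional_weightedHomogeneousSubmodule (K := K) hu
  have hinf : (weightedHomogeneousSubmodule K u (m - d₁)).map (LinearMap.mulLeft K Q₁) ⊓
      (weightedHomogeneousSubmodule K u (m - d₂)).map (LinearMap.mulLeft K Q₂) ≤
      (weightedHomogeneousSubmodule K u (m - (d₁ + d₂))).map (LinearMap.mulLeft K (Q₂ * Q₁)) := by
    rintro _ ⟨⟨a, ha, rfl⟩, b, hb, hab⟩
    simp only [LinearMap.mulLeft_apply] at hab
    obtain ⟨c, rfl⟩ := hrel.dvd_of_dvd_mul_left ⟨a, hab⟩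
    refine ⟨c, ?_, by simp [← hab]⟩
    have := IsWeightedHomogeneous.of_mul_left h₁ hQ₁ hb
    rwa [sub_sub, add_comm d₂] at this
  have hdim := Submodule.finrank_sup_add_finrank_inf_eq
    ((weightedHomogeneousSubmodule K u (m - d₁)).map (LinearMap.mulLeft K Q₁))
    ((weightedHomogeneousSubmodule K u (m - d₂)).map (LinearMap.mulLeft K Q₂))
  have hmono := Submodule.finrank_mono hinf
  rw [finrank_map_mulLeft (mul_ne_zero h₂ h₁)] at hmono
  rw [finrank_map_mulLeft h₁, finrank_map_mulLeft h₂] at hdim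
  unfold polyHilbert idealPiece
  omega

/-- A product of subspaces is equivalent to the dependent functions valued in them. -/
def Submodule.piUnivEquiv {ι : Type*} {R M : Type*} [Semiring R] [AddCommMonoid M] [Module R M]
    (p : ι → Submodule R M) : Submodule.pi Set.univ p ≃ₗ[R] ((i : ι) → p i) where
  toFun x i := ⟨x.1 i, x.2 i trivial⟩
  invFun y := ⟨fun i => y i, fun i _ => (y i).2⟩
  map_add' _ _ := rfl
  map_smul' _ _ := rfl

theorem Submodule.finrank_pi_univ {ι M : Type*} [Fintype ι] [AddCommGroup M] [Module K M]
    (p : ι → Submodule K M) [∀ i, FiniteDimensional K (p i)] :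
    Module.finrank K (Submodule.pi Set.univ p) = ∑ i, Module.finrank K (p i) := by
  rw [(Submodule.piUnivEquiv p).finrank_eq, Module.finrank_pi_fintype]

theorem smul_mem_DQ {r : ℕ} (f : Fin r → MvPolynomial (Fin n) K) (e : Fin r → ℕ)
    (a : Fin n → MvPolynomial (Fin n) K) : (∏ i, f i ^ e i) • a ∈ DQ f e := by
  simp only [DQ, Submodule.mem_iInf, Dgk, Submodule.mem_comap, map_smul, smul_eq_mul]
  exact fun i => Ideal.mul_mem_right _ _
    (Ideal.mem_span_singleton.mpr (Finset.dvd_prod_of_mem _ (Finset.mem_univ i)))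

theorem pi_idealPiece_le_gPiece {u v : Fin n → ℤ} {Q₁ Q₂ : MvPolynomial (Fin n) K} {d₁ d₂ : ℤ}
    (hQ₁ : Q₁.IsWeightedHomogeneous u d₁) (hQ₂ : Q₂.IsWeightedHomogeneous u d₂)
    {M : Submodule (MvPolynomial (Fin n) K) (Fin n → MvPolynomial (Fin n) K)}
    (hM₁ : ∀ a, Q₁ • a ∈ M) (hM₂ : ∀ a, Q₂ • a ∈ M) (m : ℤ) :
    Submodule.pi Set.univ (fun i => idealPiece u Q₁ Q₂ d₁ d₂ (m - v i)) ≤ gPiece u v M m := by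
  refine le_inf (fun x hx => ?_) (Submodule.pi_mono fun i _ => idealPiece_le hQ₁ hQ₂ _)
  have hex : ∀ i, ∃ a b, x i = Q₁ * a + Q₂ * b := fun i => by
    obtain ⟨_, ⟨a, -, rfl⟩, _, ⟨b, -, rfl⟩, hab⟩ := Submodule.mem_sup.mp (hx i trivial)
    exact ⟨a, b, hab.symm⟩
  choose a b hab using hex
  have hx' : x = Q₁ • a + Q₂ • b := funext fun i => hab i
  rw [hx']
  exact M.add_mem (hM₁ a) (hM₂ b)

theorem hpDer_le {u v : Fin n → ℤ} (hu : ∀ i, 0 < u i)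
    (M : Submodule (MvPolynomial (Fin n) K) (Fin n → MvPolynomial (Fin n) K)) (m : ℤ) :
    hpDer u v M m ≤ ∑ i, (polyHilbert K u (m - v i) : ℤ) := by
  have hfin := finiteDimensional_weightedHomogeneousSubmodule (K := K) hu
  have := (Submodule.piUnivEquiv fun i =>
    weightedHomogeneousSubmodule K u (m - v i)).symm.finiteDimensional
  have hmono := Submodule.finrank_mono (R := K) (M := Fin n → MvPolynomial (Fin n) K)
    (inf_le_right : gPiece u v M m ≤ _)
  rw [Submodule.finrank_pi_univ] at hmono
  unfold hpDer polyHilbert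
  exact_mod_cast hmono

theorem le_hpDer {u v : Fin n → ℤ} (hu : ∀ i, 0 < u i)
    {Q₁ Q₂ : MvPolynomial (Fin n) K} {d₁ d₂ : ℤ} (h₁ : Q₁ ≠ 0) (h₂ : Q₂ ≠ 0)
    (hQ₁ : Q₁.IsWeightedHomogeneous u d₁) (hQ₂ : Q₂.IsWeightedHomogeneous u d₂)
    (hrel : IsRelPrime Q₁ Q₂)
    {M : Submodule (MvPolynomial (Fin n) K) (Fin n → MvPolynomial (Fin n) K)}
    (hM₁ : ∀ a, Q₁ • a ∈ M) (hM₂ : ∀ a, Q₂ • a ∈ M) (m : ℤ) :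
    ∑ i, ((polyHilbert K u (m - (v i + d₁)) : ℤ) + polyHilbert K u (m - (v i + d₂)) -
      polyHilbert K u (m - (v i + (d₁ + d₂)))) ≤ hpDer u v M m := by
  have hfin := finiteDimensional_weightedHomogeneousSubmodule (K := K) hu
  have hfin' (i) : FiniteDimensional K (idealPiece u Q₁ Q₂ d₁ d₂ (m - v i)) :=
    Submodule.finiteDimensional_of_le (idealPiece_le hQ₁ hQ₂ _)
  have := (Submodule.piUnivEquiv fun i =>
    weightedHomogeneousSubmodule K u (m - v i)).symm.finiteDimensional
  have : FiniteDimensional K (gPiece u v M m) :=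
    Submodule.finiteDimensional_of_le (inf_le_right : gPiece u v M m ≤ _)
  have hmono := Submodule.finrank_mono (pi_idealPiece_le_gPiece (v := v) hQ₁ hQ₂ hM₁ hM₂ m)
  rw [Submodule.finrank_pi_univ] at hmono
  refine le_trans (Finset.sum_le_sum fun i _ => ?_)
    (by unfold hpDer; exact_mod_cast hmono : ∑ i, (Module.finrank K
      (idealPiece u Q₁ Q₂ d₁ d₂ (m - v i)) : ℤ) ≤ hpDer u v M m)
  have := le_finrank_idealPiece (d₂ := d₂) hu h₁ h₂ hQ₁ hrel (m - v i)
  simp only [sub_sub] at this ⊢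
  omega

end Dimension

theorem isRelPrime_prod_pow {R : Type*} [CommMonoid R] [DecompositionMonoid R] {r₁ r₂ : ℕ}
    {f₁ : Fin r₁ → R} {f₂ : Fin r₂ → R} (e₁ : Fin r₁ → ℕ) (e₂ : Fin r₂ → ℕ)
    (h : IsRelPrime (∏ i, f₁ i) (∏ i, f₂ i)) :
    IsRelPrime (∏ i, f₁ i ^ e₁ i) (∏ i, f₂ i ^ e₂ i) :=
  IsRelPrime.prod_left fun i _ => IsRelPrime.prod_right fun j _ =>
    ((h.of_prod_left i (Finset.mem_univ i)).of_prod_right j (Finset.mem_univ j)).pow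

theorem HasDerivAt.nonpos_of_nonneg_left {g : ℝ → ℝ} {d : ℝ} (hg : HasDerivAt g d 1)
    (hg1 : g 1 = 0) (h : ∀ t, 0 < t → t < 1 → 0 ≤ g t) : d ≤ 0 := by
  refine le_of_tendsto (hasDerivAt_iff_tendsto_slope_left_right.mp hg).1 ?_
  filter_upwards [Ioo_mem_nhdsLT (zero_lt_one' ℝ)] with t ht
  rw [slope_def_field, hg1, sub_zero]
  exact div_nonpos_of_nonneg_of_nonpos (h t ht.1 ht.2) (by linarith [ht.2])

theorem HasDerivAt.apply_one_nonneg {g : ℝ → ℝ} {d : ℝ} (hg : HasDerivAt g d 1)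
    (h : ∀ t, 0 < t → t < 1 → 0 ≤ g t) : 0 ≤ g 1 := by
  refine ge_of_tendsto (hg.continuousAt.tendsto.mono_left nhdsWithin_le_nhds : Filter.Tendsto g
    (nhdsWithin 1 (Set.Iio 1)) _) ?_
  filter_upwards [Ioo_mem_nhdsLT (zero_lt_one' ℝ)] with t ht using h t ht.1 ht.2

theorem hasDerivAt_zpow_one (m : ℤ) : HasDerivAt (fun t : ℝ => t ^ m) m 1 := by
  simpa using hasDerivAt_zpow m (1 : ℝ) (Or.inl one_ne_zero)

theorem hasDerivAt_sum_mul_zpow (c : ℤ →₀ ℤ) :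
    HasDerivAt (fun t : ℝ => c.sum fun m a => (a : ℝ) * t ^ m) (chi c) 1 := by
  have h := HasDerivAt.fun_sum (u := c.support) fun m _ =>
    (hasDerivAt_zpow_one m).const_mul (c m : ℝ)
  have hchi : (chi c : ℝ) = ∑ m ∈ c.support, (c m : ℝ) * (m : ℝ) := by
    simp [chi, Finsupp.sum, mul_comm]
  exact hchi ▸ h

theorem numRel.bounds {K : Type} [Field K] {n : ℕ} {u v : Fin n → ℤ} (hu : ∀ i, 0 < u i)
    {Q₁ Q₂ : MvPolynomial (Fin n) K} {d₁ d₂ : ℤ} (h₁ : Q₁ ≠ 0) (h₂ : Q₂ ≠ 0)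
    (hQ₁ : Q₁.IsWeightedHomogeneous u d₁) (hQ₂ : Q₂.IsWeightedHomogeneous u d₂)
    (hrel : IsRelPrime Q₁ Q₂)
    {M : Submodule (MvPolynomial (Fin n) K) (Fin n → MvPolynomial (Fin n) K)}
    (hM₁ : ∀ a, Q₁ • a ∈ M) (hM₂ : ∀ a, Q₂ • a ∈ M) {c : ℤ →₀ ℤ}
    (hc : numRel u c (hpDer u v M)) {t : ℝ} (ht0 : 0 < t) (ht1 : t < 1) :
    ∑ i, (t ^ (v i + d₁) + t ^ (v i + d₂) - t ^ (v i + (d₁ + d₂))) ≤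
        c.sum (fun m a => (a : ℝ) * t ^ m) ∧
      c.sum (fun m a => (a : ℝ) * t ^ m) ≤ ∑ i, t ^ v i := by
  set H : ℝ := ∏ i, (1 - t ^ u i)⁻¹ with hH
  have hpos (i) : 0 < 1 - t ^ u i :=
    sub_pos.mpr (by simpa using zpow_lt_zpow_right_of_lt_one₀ ht0 ht1 (hu i))
  have hPpos : 0 < ∏ i, (1 - t ^ u i) := Finset.prod_pos fun i _ => hpos i
  have hPH : (∏ i, (1 - t ^ u i)) * H = 1 := by
    rw [hH, Finset.prod_inv_distrib, mul_inv_cancel₀ hPpos.ne']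
  have hshift (a : ℤ) : HasSum (fun m : ℤ => (polyHilbert K u (m - a) : ℝ) * t ^ m) (t ^ a * H) :=
    hasSum_comp_sub_mul_zpow (F := fun m => (polyHilbert K u m : ℝ)) ht0.ne'
      (hasSum_polyHilbert hu ht0 ht1) a
  have hupper : HasSum (fun m : ℤ => ∑ i, (polyHilbert K u (m - v i) : ℝ) * t ^ m)
      (∑ i, t ^ v i * H) := hasSum_sum fun i _ => hshift (v i)
  have hlower := hasSum_sum (s := Finset.univ) fun i _ =>
    ((hshift (v i + d₁)).add (hshift (v i + d₂))).sub (hshift (v i + (d₁ + d₂)))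
  have hle (m : ℤ) : (hpDer u v M m : ℝ) * t ^ m ≤
      ∑ i, (polyHilbert K u (m - v i) : ℝ) * t ^ m := by
    rw [← Finset.sum_mul]
    exact mul_le_mul_of_nonneg_right (by exact_mod_cast hpDer_le hu M m) (by positivity)
  have hge (m : ℤ) : ∑ i, ((polyHilbert K u (m - (v i + d₁)) : ℝ) * t ^ m +
      polyHilbert K u (m - (v i + d₂)) * t ^ m -
      polyHilbert K u (m - (v i + (d₁ + d₂))) * t ^ m) ≤ (hpDer u v M m : ℝ) * t ^ m := by
    simp_rw [← add_mul, ← sub_mul, ← Finset.sum_mul]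
    exact mul_le_mul_of_nonneg_right
      (by exact_mod_cast le_hpDer hu h₁ h₂ hQ₁ hQ₂ hrel hM₁ hM₂ m) (by positivity)
  have hsum : Summable fun m : ℤ => (hpDer u v M m : ℝ) * t ^ m :=
    Summable.of_nonneg_of_le (fun m => mul_nonneg (by simp [hpDer]) (by positivity)) hle
      hupper.summable
  have hcs := hc.sum_mul_zpow ht0.ne' hsum.hasSum
  have hle' := mul_le_mul_of_nonneg_left (hasSum_le hle hsum.hasSum hupper) hPpos.le
  have hge' := mul_le_mul_of_nonneg_left (hasSum_le hge hlower hsum.hasSum) hPpos.le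
  simp_rw [← add_mul, ← sub_mul] at hge'
  rw [← Finset.sum_mul, mul_left_comm, hPH, mul_one] at hle' hge'
  rw [hcs]
  exact ⟨hge', hle'⟩

/-- If `Q₁, Q₂` are quasi-homogeneous w.r.t. `u` (with
`u + v = k·(1,…,1)`) and their reductions have no common factor, then
`χ(D^{(u,v)}(Q₁) + D^{(u,v)}(Q₂)) = v₁ + ⋯ + vₙ`. -/
theorem chi_sum_of_relPrime {K : Type} [Field K] [CharZero K] {n r₁ r₂ : ℕ}
    (u v : Fin n → ℤ) (k : ℤ) (hu : ∀ i, 0 < u i) (huv : ∀ i, u i + v i = k)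
    (Q₁ Q₂ : MvPolynomial (Fin n) K)
    (f₁ : Fin r₁ → MvPolynomial (Fin n) K) (e₁ : Fin r₁ → ℕ)
    (f₂ : Fin r₂ → MvPolynomial (Fin n) K) (e₂ : Fin r₂ → ℕ)
    (hirr₁ : ∀ i, Irreducible (f₁ i)) (hfac₁ : Q₁ = ∏ i, f₁ i ^ e₁ i)
    (hirr₂ : ∀ i, Irreducible (f₂ i)) (hfac₂ : Q₂ = ∏ i, f₂ i ^ e₂ i)
    (d₁ d₂ : ℤ) (hQ₁ : Q₁.IsWeightedHomogeneous u d₁) (hQ₂ : Q₂.IsWeightedHomogeneous u d₂)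
    -- the reductions `∏ᵢ f₁ᵢ` and `∏ᵢ f₂ᵢ` have no common factor
    (hrp : IsRelPrime (∏ i, f₁ i) (∏ i, f₂ i))
    -- numerator of `HP_{D(Q₁)+D(Q₂)}`
    (c : ℤ →₀ ℤ) (hc : numRel u c (hpDer u v (DQ f₁ e₁ ⊔ DQ f₂ e₂))) :
    chi c = ∑ i, v i := by
  have h₁ : Q₁ ≠ 0 :=
    hfac₁ ▸ Finset.prod_ne_zero_iff.mpr fun i _ => pow_ne_zero _ (hirr₁ i).ne_zero
  have h₂ : Q₂ ≠ 0 :=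
    hfac₂ ▸ Finset.prod_ne_zero_iff.mpr fun i _ => pow_ne_zero _ (hirr₂ i).ne_zero
  have hrel : IsRelPrime Q₁ Q₂ := by
    rw [hfac₁, hfac₂]
    exact isRelPrime_prod_pow e₁ e₂ hrp
  have hM₁ (a : Fin n → MvPolynomial (Fin n) K) : Q₁ • a ∈ DQ f₁ e₁ ⊔ DQ f₂ e₂ :=
    Submodule.mem_sup_left (hfac₁ ▸ smul_mem_DQ f₁ e₁ a)
  have hM₂ (a : Fin n → MvPolynomial (Fin n) K) : Q₂ • a ∈ DQ f₁ e₁ ⊔ DQ f₂ e₂ :=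
    Submodule.mem_sup_right (hfac₂ ▸ smul_mem_DQ f₂ e₂ a)
  have hbounds {t : ℝ} (ht0 : 0 < t) (ht1 : t < 1) :=
    hc.bounds hu h₁ h₂ hQ₁ hQ₂ hrel hM₁ hM₂ ht0 ht1
  have hC := hasDerivAt_sum_mul_zpow c
  have hU : HasDerivAt (fun t : ℝ => ∑ i, t ^ v i) (∑ i, (v i : ℝ)) 1 :=
    HasDerivAt.fun_sum fun i _ => hasDerivAt_zpow_one (v i)
  have hL : HasDerivAt
      (fun t : ℝ => ∑ i, (t ^ (v i + d₁) + t ^ (v i + d₂) - t ^ (v i + (d₁ + d₂))))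
      (∑ i, (v i : ℝ)) 1 := by
    refine HasDerivAt.fun_sum fun i _ => ?_
    have h := ((hasDerivAt_zpow_one (v i + d₁)).fun_add (hasDerivAt_zpow_one (v i + d₂))).fun_sub
      (hasDerivAt_zpow_one (v i + (d₁ + d₂)))
    have hv : (v i : ℝ) = ((v i + d₁ : ℤ) : ℝ) + ((v i + d₂ : ℤ) : ℝ) -
        ((v i + (d₁ + d₂) : ℤ) : ℝ) := by
      push_cast
      ring
    exact hv ▸ h
  have hUC := hU.fun_sub hC
  have hCL := hC.fun_sub hL
  have hUC0 (t : ℝ) (ht0 : 0 < t) (ht1 : t < 1) := sub_nonneg.mpr (hbounds ht0 ht1).2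
  have hCL0 (t : ℝ) (ht0 : 0 < t) (ht1 : t < 1) := sub_nonneg.mpr (hbounds ht0 ht1).1
  have hUC1 := hUC.apply_one_nonneg hUC0
  have hCL1 := hCL.apply_one_nonneg hCL0
  simp only [one_zpow, add_sub_cancel_right] at hUC1 hCL1
  have hUC' := hUC.nonpos_of_nonneg_left (by simp only [one_zpow]; linarith) hUC0
  have hCL' := hCL.nonpos_of_nonneg_left
    (by simp only [one_zpow, add_sub_cancel_right]; linarith) hCL0
  have : (chi c : ℝ) = ∑ i, (v i : ℝ) := by linarith
  exact_mod_cast this
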